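/- arXiv:math/0402234 — 4 statements merged into one kernel-verified Lean document; each statement's English description precedes it below -/
import Mathlib

section
/- Let g be a four-dimensional real Lie algebra whose derived algebra [g,g] is abelian of dimension 3. Then g cannot be written as a direct sum g = h1 ⊕ h2 (as vector spaces) of two abelian Lie subalgebras h1, h2 each of dimension 2. In particular, the Lie algebras 𝔯₄, 𝔯_{4,λ} (λ≠0), 𝔯_{4,μ,λ} and 𝔯'_{4,μ,λ} admit no decomposition of type ℝ² ⋈ ℝ². -/
/-- If the derived algebra of `g` is abelian of codimension one and `x` lies outside it, then
every element of the derived algebra is of the form `⁅x, y⁆`. -/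
theorem derivedSeries_one_le_range_ad {K g : Type*} [Field K] [LieRing g] [LieAlgebra K g]
    [Module.Finite K g]
    (hab : IsLieAbelian (LieAlgebra.derivedSeries K g 1))
    (hcodim : Module.finrank K g = Module.finrank K (LieAlgebra.derivedSeries K g 1) + 1)
    {x : g} (hx : x ∉ LieAlgebra.derivedSeries K g 1) :
    (LieAlgebra.derivedSeries K g 1).toSubmodule ≤ LinearMap.range (LieAlgebra.ad K g x) := by
  set D := LieAlgebra.derivedSeries K g 1 with hD
  have hlt : D.toSubmodule < D.toSubmodule ⊔ K ∙ x :=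
    lt_of_le_of_ne le_sup_left fun h ↦
      hx (h.symm ▸ le_sup_right (a := D.toSubmodule) (Submodule.mem_span_singleton_self x) :
        x ∈ D.toSubmodule)
  have htop : D.toSubmodule ⊔ K ∙ x = ⊤ := by
    apply Submodule.eq_top_of_finrank_eq
    have h1 := Submodule.finrank_lt_finrank_of_lt hlt
    have h2 := Submodule.finrank_le (D.toSubmodule ⊔ K ∙ x)
    have h3 : Module.finrank K D.toSubmodule = Module.finrank K D := rfl
    omega
  have hdecomp (a : g) : ∃ d ∈ D, ∃ t : K, d + t • x = a := by
    have ha : a ∈ D.toSubmodule ⊔ K ∙ x := htop ▸ Submodule.mem_top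
    obtain ⟨d, hd, y, hy, rfl⟩ := Submodule.mem_sup.mp ha
    obtain ⟨t, rfl⟩ := Submodule.mem_span_singleton.mp hy
    exact ⟨d, hd, t, rfl⟩
  have hspan : D.toSubmodule = Submodule.span K
      {⁅a, b⁆ | (a ∈ (⊤ : LieIdeal K g)) (b ∈ (⊤ : LieIdeal K g))} := by
    rw [hD, LieAlgebra.derivedSeries_def, LieAlgebra.derivedSeriesOfIdeal_succ,
      LieAlgebra.derivedSeriesOfIdeal_zero, LieSubmodule.lieIdeal_oper_eq_linear_span']
  rw [hspan, Submodule.span_le]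
  rintro _ ⟨a, -, b, -, rfl⟩
  obtain ⟨d, hd, s, rfl⟩ := hdecomp a
  obtain ⟨e, he, t, rfl⟩ := hdecomp b
  have hde : ⁅d, e⁆ = 0 :=
    congrArg Subtype.val (LieModule.IsTrivial.trivial (⟨d, hd⟩ : D) (⟨e, he⟩ : D))
  refine ⟨s • e - t • d, ?_⟩
  rw [LieAlgebra.ad_apply]
  simp only [lie_sub, lie_smul, add_lie, lie_add, smul_lie, hde, lie_self, smul_zero]
  rw [← lie_skew x d]
  module

/-- If the derived algebra of `g` is abelian of codimension one, then it contains every abelian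
subalgebra of dimension at least two. -/
theorem abelian_le_derivedSeries_one {K g : Type*} [Field K] [LieRing g] [LieAlgebra K g]
    [Module.Finite K g]
    (hab : IsLieAbelian (LieAlgebra.derivedSeries K g 1))
    (hcodim : Module.finrank K g = Module.finrank K (LieAlgebra.derivedSeries K g 1) + 1)
    (h : LieSubalgebra K g) (hh : IsLieAbelian h) (hrank : 2 ≤ Module.finrank K h) :
    h.toSubmodule ≤ (LieAlgebra.derivedSeries K g 1).toSubmodule := by
  intro x hxh
  by_contra hx
  have hrange := Submodule.finrank_mono (derivedSeries_one_le_range_ad hab hcodim hx)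
  have hker : h.toSubmodule ≤ LinearMap.ker (LieAlgebra.ad K g x) := fun y hy ↦
    congrArg Subtype.val (LieModule.IsTrivial.trivial (⟨x, hxh⟩ : h) (⟨y, hy⟩ : h))
  have hker' := Submodule.finrank_mono hker
  have hsum := LinearMap.finrank_range_add_finrank_ker (LieAlgebra.ad K g x)
  have h1 : Module.finrank K h.toSubmodule = Module.finrank K h := rfl
  have h2 : Module.finrank K (LieAlgebra.derivedSeries K g 1).toSubmodule =
    Module.finrank K (LieAlgebra.derivedSeries K g 1) := rfl
  omega

/-- A four-dimensional real Lie algebra whose derived algebra is abelian of dimension 3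
cannot be written as a direct sum (of vector spaces) of two 2-dimensional abelian Lie
subalgebras; this applies to `𝔯₄`, `𝔯_{4,λ}` (λ ≠ 0), `𝔯_{4,μ,λ}` and `𝔯'_{4,μ,λ}`. -/
theorem no_R2_bowtie_R2
    (g : Type*) [LieRing g] [LieAlgebra ℝ g] [Module.Finite ℝ g]
    (hdim : Module.finrank ℝ g = 4)
    (habelian : IsLieAbelian (LieAlgebra.derivedSeries ℝ g 1))
    (hdim' : Module.finrank ℝ (LieAlgebra.derivedSeries ℝ g 1) = 3) :
    ¬ ∃ h1 h2 : LieSubalgebra ℝ g,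
        IsLieAbelian h1 ∧ IsLieAbelian h2 ∧
        Module.finrank ℝ h1 = 2 ∧ Module.finrank ℝ h2 = 2 ∧
        IsCompl h1.toSubmodule h2.toSubmodule := by
  rintro ⟨h1, h2, hab1, hab2, hr1, hr2, hcompl⟩
  have hcodim : Module.finrank ℝ g =
      Module.finrank ℝ (LieAlgebra.derivedSeries ℝ g 1) + 1 := by omega
  have hle := sup_le (abelian_le_derivedSeries_one habelian hcodim h1 hab1 hr1.ge)
    (abelian_le_derivedSeries_one habelian hcodim h2 hab2 hr2.ge)
  rw [hcompl.sup_eq_top] at hle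
  have hfin := Submodule.finrank_mono hle
  rw [finrank_top] at hfin
  have hD : Module.finrank ℝ (LieAlgebra.derivedSeries ℝ g 1).toSubmodule =
    Module.finrank ℝ (LieAlgebra.derivedSeries ℝ g 1) := rfl
  omega
end

section
/- Let g be a Lie algebra over a field which is the direct sum, as a vector space, of two abelian Lie subalgebras g₊ and g₋. Then g is 2-step solvable, i.e., the derived algebra [g,g] is abelian: [[x,y],[u,v]] = 0 for all x, y, u, v ∈ g. -/
/-- The key case: commutators of elements of two abelian subalgebras spanning the Lie algebra
commute with each other. -/
theorem lie_lie_lie_eq_zero_of_abelian_of_codisjoint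
    {R L : Type*} [CommRing R] [LieRing L] [LieAlgebra R L] {A B : LieSubalgebra R L}
    (hA : ∀ x ∈ A, ∀ y ∈ A, ⁅x, y⁆ = 0) (hB : ∀ x ∈ B, ∀ y ∈ B, ⁅x, y⁆ = 0)
    (hAB : ∀ x : L, ∃ a ∈ A, ∃ b ∈ B, a + b = x)
    {a b a' b' : L} (ha : a ∈ A) (hb : b ∈ B) (ha' : a' ∈ A) (hb' : b' ∈ B) :
    ⁅⁅a', b'⁆, ⁅a, b⁆⁆ = 0 := by
  obtain ⟨p, hp, m, hm, hpm⟩ := hAB ⁅b', a⁆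
  obtain ⟨q, hq, n, hn, hqn⟩ := hAB ⁅a', b⁆
  have h₁ : ⁅b', ⁅a, b⁆⁆ = ⁅p, b⁆ := by
    rw [leibniz_lie, ← hpm, hB b' hb' b hb, add_lie, hB m hm b hb, lie_zero, add_zero, add_zero]
  have h₂ : ⁅a', ⁅p, b⁆⁆ = ⁅p, n⁆ := by
    rw [leibniz_lie, hA a' ha' p hp, ← hqn, lie_add, hA p hp q hq, zero_lie, zero_add, zero_add]
  have h₃ : ⁅a', ⁅a, b⁆⁆ = ⁅a, n⁆ := by
    rw [leibniz_lie, hA a' ha' a ha, ← hqn, lie_add, hA a ha q hq, zero_lie, zero_add, zero_add]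
  have h₄ : ⁅b', ⁅a, n⁆⁆ = ⁅p, n⁆ := by
    rw [leibniz_lie, ← hpm, hB b' hb' n hn, add_lie, hB m hm n hn, lie_zero, add_zero, add_zero]
  rw [lie_lie, h₁, h₂, h₃, h₄, sub_self]

/-- If a Lie algebra over a field is the vector-space direct sum of two abelian Lie
subalgebras, then it is 2-step solvable: the derived algebra is abelian. -/
theorem two_step_solvable_of_abelian_bowtie
    (K : Type*) [Field K] (g : Type*) [LieRing g] [LieAlgebra K g]
    (gp gm : LieSubalgebra K g)
    (hp : IsLieAbelian gp) (hm : IsLieAbelian gm)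
    (hcompl : IsCompl gp.toSubmodule gm.toSubmodule) :
    ∀ x y u v : g, ⁅⁅x, y⁆, ⁅u, v⁆⁆ = 0 := by
  have hA : ∀ x ∈ gp, ∀ y ∈ gp, ⁅x, y⁆ = 0 := fun x hx y hy =>
    congrArg Subtype.val (hp.trivial ⟨x, hx⟩ ⟨y, hy⟩)
  have hB : ∀ x ∈ gm, ∀ y ∈ gm, ⁅x, y⁆ = 0 := fun x hx y hy =>
    congrArg Subtype.val (hm.trivial ⟨x, hx⟩ ⟨y, hy⟩)
  have hAB : ∀ x : g, ∃ a ∈ gp, ∃ b ∈ gm, a + b = x := fun x =>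
    Submodule.mem_sup.mp (hcompl.sup_eq_top ▸ Submodule.mem_top)
  have split_lie : ∀ x y : g, ∃ a ∈ gp, ∃ b ∈ gm, ∃ a' ∈ gp, ∃ b' ∈ gm,
      ⁅x, y⁆ = ⁅a, b⁆ - ⁅a', b'⁆ := by
    intro x y
    obtain ⟨a, ha, b, hb, rfl⟩ := hAB x
    obtain ⟨c, hc, d, hd, rfl⟩ := hAB y
    refine ⟨a, ha, d, hd, c, hc, b, hb, ?_⟩
    rw [add_lie, lie_add, lie_add, hA a ha c hc, hB b hb d hd, ← lie_skew b c]
    abel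
  intro x y u v
  obtain ⟨a, ha, b, hb, a', ha', b', hb', hxy⟩ := split_lie x y
  obtain ⟨c, hc, d, hd, c', hc', d', hd', huv⟩ := split_lie u v
  have key {s t s' t' : g} (hs : s ∈ gp) (ht : t ∈ gm) (hs' : s' ∈ gp) (ht' : t' ∈ gm) :
      ⁅⁅s', t'⁆, ⁅s, t⁆⁆ = 0 :=
    lie_lie_lie_eq_zero_of_abelian_of_codisjoint hA hB hAB hs ht hs' ht'
  rw [hxy, huv, sub_lie, lie_sub, lie_sub, key hc hd ha hb, key hc' hd' ha hb,
    key hc hd ha' hb', key hc' hd' ha' hb', sub_self]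
end

section
/- Let g be a four-dimensional real Lie algebra containing a Lie ideal a with a basis z, w satisfying [z,w] = w, and a Lie subalgebra h complementary to a as a vector subspace (g = h ⊕ a) with a basis x, y satisfying [x,y] = y. Then g ≅ aff(ℝ) × aff(ℝ): there exist Lie ideals b1 and b2 of g with g = b1 ⊕ b2 as vector spaces, [b1,b2] = 0, and each b_i has a basis u_i, v_i with [u_i, v_i] = v_i. -/
section AffineIdeal

variable {g : Type*} [LieRing g] [LieAlgebra ℝ g] {a : LieIdeal ℝ g} {z w : g}

theorem LieIdeal.mem_ker_iff_forall_lie_eq_zero {t : g} :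
    t ∈ LieModule.ker ℝ g a ↔ ∀ q ∈ a, ⁅t, q⁆ = 0 := by
  simp [LieModule.mem_ker, Subtype.ext_iff]

theorem LieIdeal.mem_ker_iff_of_span_pair (hspan : Submodule.span ℝ {z, w} = a.toSubmodule)
    {t : g} : t ∈ LieModule.ker ℝ g a ↔ ⁅t, z⁆ = 0 ∧ ⁅t, w⁆ = 0 := by
  have hmem (q : g) : q ∈ a ↔ ∃ c d : ℝ, c • z + d • w = q := by
    rw [← LieSubmodule.mem_toSubmodule, ← hspan, Submodule.mem_span_pair]
  rw [LieIdeal.mem_ker_iff_forall_lie_eq_zero]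
  refine ⟨fun ht => ⟨ht z ((hmem z).2 ⟨1, 0, by simp⟩), ht w ((hmem w).2 ⟨0, 1, by simp⟩)⟩, ?_⟩
  rintro ⟨htz, htw⟩ q hq
  obtain ⟨c, d, rfl⟩ := (hmem q).1 hq
  simp [htz, htw]

/-- The affine Lie algebra is centerless. -/
theorem LieIdeal.disjoint_ker_of_affine_basis (hindep : LinearIndependent ℝ ![z, w])
    (hspan : Submodule.span ℝ {z, w} = a.toSubmodule) (hzw : ⁅z, w⁆ = w) :
    Disjoint (LieModule.ker ℝ g a).toSubmodule a.toSubmodule := by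
  rw [Submodule.disjoint_def]
  intro s hs hsa
  obtain ⟨hsz, hsw⟩ := (LieIdeal.mem_ker_iff_of_span_pair hspan).1 hs
  rw [← hspan, Submodule.mem_span_pair] at hsa
  obtain ⟨c, d, rfl⟩ := hsa
  have hwz : ⁅w, z⁆ = -w := by rw [← lie_skew, hzw]
  have hw0 : w ≠ 0 := hindep.ne_zero 1
  simp [hzw, hw0] at hsw
  simp [hwz, hw0] at hsz
  simp [hsw, hsz]

/-- Every derivation of the affine Lie algebra is inner. -/
theorem LieIdeal.exists_sub_mem_ker_of_affine_basis (hindep : LinearIndependent ℝ ![z, w])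
    (hspan : Submodule.span ℝ {z, w} = a.toSubmodule) (hzw : ⁅z, w⁆ = w) (t : g) :
    ∃ s ∈ a, t - s ∈ LieModule.ker ℝ g a := by
  have hmem (q : g) : q ∈ a ↔ ∃ c d : ℝ, c • z + d • w = q := by
    rw [← LieSubmodule.mem_toSubmodule, ← hspan, Submodule.mem_span_pair]
  have hwz : ⁅w, z⁆ = -w := by rw [← lie_skew, hzw]
  obtain ⟨α, β, hαβ⟩ := (hmem _).1 (lie_mem_right ℝ g a t z ((hmem z).2 ⟨1, 0, by simp⟩))
  obtain ⟨γ, δ, hγδ⟩ := (hmem _).1 (lie_mem_right ℝ g a t w ((hmem w).2 ⟨0, 1, by simp⟩))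
  have hleibniz : (-γ) • z + α • w = 0 := by
    have := leibniz_lie t z w
    rw [hzw, ← hαβ, ← hγδ] at this
    simp only [add_lie, smul_lie, lie_add, lie_smul, hzw, lie_self, smul_zero, add_zero,
      zero_add] at this
    linear_combination (norm := module) -this
  obtain ⟨hγ, hα⟩ := LinearIndependent.pair_iff.1 hindep _ _ hleibniz
  obtain rfl : γ = 0 := neg_eq_zero.1 hγ
  subst hα
  refine ⟨δ • z + (-β) • w, (hmem _).2 ⟨_, _, rfl⟩, ?_⟩
  rw [LieIdeal.mem_ker_iff_of_span_pair hspan]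
  simp [sub_lie, ← hαβ, ← hγδ, hzw, hwz]

theorem LieIdeal.isCompl_ker_of_affine_basis (hindep : LinearIndependent ℝ ![z, w])
    (hspan : Submodule.span ℝ {z, w} = a.toSubmodule) (hzw : ⁅z, w⁆ = w) :
    IsCompl (LieModule.ker ℝ g a).toSubmodule a.toSubmodule := by
  refine ⟨LieIdeal.disjoint_ker_of_affine_basis hindep hspan hzw, ?_⟩
  rw [codisjoint_iff, Submodule.eq_top_iff']
  intro t
  obtain ⟨s, hs, hts⟩ := LieIdeal.exists_sub_mem_ker_of_affine_basis hindep hspan hzw t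
  exact Submodule.mem_sup.2 ⟨t - s, hts, s, hs, sub_add_cancel t s⟩

end AffineIdeal


/-- If a four-dimensional real Lie algebra `g` is a semidirect product `h ⋉ a` with
`h ≅ aff(ℝ) ≅ a` (`a` an ideal), then `g ≅ aff(ℝ) × aff(ℝ)`: there are complementary
commuting Lie ideals `b1`, `b2`, each with a basis `u, v` satisfying `⁅u,v⁆ = v`. -/
theorem aff_semidirect_aff_is_direct
    (g : Type*) [LieRing g] [LieAlgebra ℝ g] [Module.Finite ℝ g]
    (hdim : Module.finrank ℝ g = 4)
    (a : LieIdeal ℝ g) (z w : g) (hz : z ∈ a) (hw : w ∈ a)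
    (hzw_indep : LinearIndependent ℝ ![z, w])
    (hzw_span : Submodule.span ℝ {z, w} = a.toSubmodule)
    (hzw : ⁅z, w⁆ = w)
    (h : LieSubalgebra ℝ g) (x y : g) (hx : x ∈ h) (hy : y ∈ h)
    (hxy_indep : LinearIndependent ℝ ![x, y])
    (hxy_span : Submodule.span ℝ {x, y} = h.toSubmodule)
    (hxy : ⁅x, y⁆ = y)
    (hcompl : IsCompl h.toSubmodule a.toSubmodule) :
    ∃ b1 b2 : LieIdeal ℝ g,
      IsCompl b1.toSubmodule b2.toSubmodule ∧
      (∀ p ∈ b1, ∀ q ∈ b2, ⁅p, q⁆ = 0) ∧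
      (∃ u v : g, u ∈ b1 ∧ v ∈ b1 ∧ LinearIndependent ℝ ![u, v] ∧
        Submodule.span ℝ {u, v} = b1.toSubmodule ∧ ⁅u, v⁆ = v) ∧
      (∃ u v : g, u ∈ b2 ∧ v ∈ b2 ∧ LinearIndependent ℝ ![u, v] ∧
        Submodule.span ℝ {u, v} = b2.toSubmodule ∧ ⁅u, v⁆ = v) := by
  have hker := LieIdeal.isCompl_ker_of_affine_basis hzw_indep hzw_span hzw
  obtain ⟨s, hs, hxs⟩ :=
    LieIdeal.exists_sub_mem_ker_of_affine_basis hzw_indep hzw_span hzw x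
  obtain ⟨r, hr, hyr⟩ :=
    LieIdeal.exists_sub_mem_ker_of_affine_basis hzw_indep hzw_span hzw y
  have eq_zero_of_mem {q : g} (hq : q ∈ LieModule.ker ℝ g a) (hqa : q ∈ a) : q = 0 :=
    Submodule.disjoint_def.1 hker.disjoint q hq hqa
  refine ⟨LieModule.ker ℝ g a, a, hker,
    fun p hp => LieIdeal.mem_ker_iff_forall_lie_eq_zero.1 hp,
    ⟨x - s, y - r, hxs, hyr, ?_, ?_, ?_⟩, z, w, hz, hw, hzw_indep, hzw_span, hzw⟩
  · rw [LinearIndependent.pair_iff] at hxy_indep ⊢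
    intro c d hcd
    refine hxy_indep c d (Submodule.disjoint_def.1 hcompl.disjoint _
      (add_mem (h.smul_mem c hx) (h.smul_mem d hy)) ?_)
    have : c • x + d • y = c • s + d • r := by linear_combination (norm := module) hcd
    rw [this]
    exact add_mem (a.smul_mem c hs) (a.smul_mem d hr)
  · refine le_antisymm (Submodule.span_le.2 (Set.pair_subset hxs hyr)) fun m hm => ?_
    obtain ⟨k, hk, q, hq, rfl⟩ := Submodule.mem_sup.1
      (hcompl.sup_eq_top ▸ Submodule.mem_top : m ∈ h.toSubmodule ⊔ a.toSubmodule)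
    rw [← hxy_span, Submodule.mem_span_pair] at hk
    obtain ⟨c, d, rfl⟩ := hk
    refine Submodule.mem_span_pair.2 ⟨c, d, (sub_eq_zero.1 (eq_zero_of_mem
      (sub_mem hm (add_mem (Submodule.smul_mem _ c hxs) (Submodule.smul_mem _ d hyr))) ?_)).symm⟩
    have : c • x + d • y + q - (c • (x - s) + d • (y - r)) = q + (c • s + d • r) := by module
    rw [this]
    exact add_mem hq (add_mem (a.smul_mem c hs) (a.smul_mem d hr))
  · refine sub_eq_zero.1 (eq_zero_of_mem (sub_mem (lie_mem_right ℝ g _ _ _ hyr) hyr) ?_)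
    have : ⁅x - s, y - r⁆ - (y - r) = r - ⁅x, r⁆ - ⁅s, y - r⁆ := by
      rw [sub_lie, lie_sub x, hxy]
      abel
    rw [this]
    exact sub_mem (sub_mem hr (lie_mem_right ℝ g a x r hr)) (lie_mem_left ℝ g a s _ hs)
end

section
/- Let g be a four-dimensional real Lie algebra containing a Lie ideal a with a basis z, w satisfying [z,w] = w, and a 2-dimensional abelian Lie subalgebra h complementary to a as a vector subspace (g = h ⊕ a). Then g ≅ ℝ² × aff(ℝ): there exist Lie ideals b1 and b2 of g with g = b1 ⊕ b2 as vector spaces, [b1,b2] = 0, b1 is 2-dimensional abelian, and b2 has a basis u, v with [u,v] = v. -/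
/-- If `a` is a Lie ideal spanned by linearly independent `z`, `w` with `⁅z, w⁆ = w`, then every
element of the ambient Lie algebra acts on `a` as an element of `a` does. -/
theorem LieIdeal.exists_sub_mem_ker_of_aff {K g : Type*} [Field K] [LieRing g] [LieAlgebra K g]
    (a : LieIdeal K g) {z w : g} (hind : LinearIndependent K ![z, w])
    (hspan : Submodule.span K {z, w} = a.toSubmodule) (hzw : ⁅z, w⁆ = w) (x : g) :
    ∃ y ∈ a, x - y ∈ LieModule.ker K g a := by
  have mem_a (q : g) : q ∈ a ↔ ∃ s t : K, s • z + t • w = q := by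
    rw [← LieSubmodule.mem_toSubmodule, ← hspan, Submodule.mem_span_pair]
  have hwz : ⁅w, z⁆ = -w := by rw [← lie_skew, hzw]
  have hz : z ∈ a := (mem_a z).2 ⟨1, 0, by simp⟩
  have hw : w ∈ a := (mem_a w).2 ⟨0, 1, by simp⟩
  obtain ⟨α, β, hxz⟩ := (mem_a _).1 (lie_mem_right K g a x z hz)
  obtain ⟨γ, δ, hxw⟩ := (mem_a _).1 (lie_mem_right K g a x w hw)
  have jacobi := leibniz_lie x z w
  rw [hzw, ← hxz, ← hxw] at jacobi
  simp only [add_lie, lie_add, smul_lie, lie_smul, lie_self, hzw, smul_zero, zero_add,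
    add_zero] at jacobi
  obtain ⟨hγ, hα⟩ := LinearIndependent.pair_iff.1 hind γ (-α) (by
    linear_combination (norm := module) jacobi)
  rw [neg_eq_zero] at hα
  subst hγ hα
  refine ⟨δ • z - β • w, (mem_a _).2 ⟨δ, -β, by module⟩, ?_⟩
  rw [LieModule.mem_ker]
  rintro ⟨q, hq⟩
  obtain ⟨s, t, rfl⟩ := (mem_a q).1 hq
  refine Subtype.ext ?_
  change ⁅x - (δ • z - β • w), s • z + t • w⁆ = 0
  simp only [sub_lie, lie_add, smul_lie, lie_smul, lie_self, hzw, hwz, ← hxz, ← hxw]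
  module

/-- A Lie ideal spanned by linearly independent `z`, `w` with `⁅z, w⁆ = w` has trivial centre, hence
meets its centralizer trivially. -/
theorem LieIdeal.disjoint_ker_of_aff {K g : Type*} [Field K] [LieRing g] [LieAlgebra K g]
    (a : LieIdeal K g) {z w : g} (hind : LinearIndependent K ![z, w])
    (hspan : Submodule.span K {z, w} = a.toSubmodule) (hzw : ⁅z, w⁆ = w) :
    Disjoint (LieModule.ker K g a).toSubmodule a.toSubmodule := by
  have hz : z ∈ a.toSubmodule := hspan ▸ Submodule.subset_span (by simp)
  have hw : w ∈ a.toSubmodule := hspan ▸ Submodule.subset_span (by simp)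
  have hw0 : w ≠ 0 := hind.ne_zero 1
  have hwz : ⁅w, z⁆ = -w := by rw [← lie_skew, hzw]
  rw [Submodule.disjoint_def]
  intro x hx hxa
  rw [LieSubmodule.mem_toSubmodule, LieModule.mem_ker] at hx
  rw [← hspan, Submodule.mem_span_pair] at hxa
  obtain ⟨s, t, rfl⟩ := hxa
  have h1 := congrArg Subtype.val (hx ⟨z, hz⟩)
  have h2 := congrArg Subtype.val (hx ⟨w, hw⟩)
  simp [hzw, hwz, hw0] at h1 h2
  simp [h1, h2]

/-- A Lie ideal with a complementary abelian Lie subalgebra contains every bracket. -/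
theorem LieIdeal.lie_mem_of_codisjoint_isLieAbelian {R g : Type*} [CommRing R] [LieRing g]
    [LieAlgebra R g] (a : LieIdeal R g) (h : LieSubalgebra R g) [IsLieAbelian h]
    (hcod : Codisjoint h.toSubmodule a.toSubmodule) (x y : g) : ⁅x, y⁆ ∈ a := by
  obtain ⟨p, q, hp, hq, rfl⟩ := Submodule.codisjoint_iff_exists_add_eq.1 hcod x
  obtain ⟨p', q', hp', hq', rfl⟩ := Submodule.codisjoint_iff_exists_add_eq.1 hcod y
  have hpp : ⁅p, p'⁆ = 0 :=
    congrArg Subtype.val (trivial_lie_zero h h (⟨p, hp⟩ : h) (⟨p', hp'⟩ : h))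
  rw [add_lie, lie_add, hpp, zero_add]
  exact add_mem (lie_mem_right R g a p q' hq') (lie_mem_left R g a q _ hq)

/-- If a four-dimensional real Lie algebra `g` is a semidirect product `h ⋉ a` with `h`
2-dimensional abelian and `a` an ideal isomorphic to `aff(ℝ)`, then `g ≅ ℝ² × aff(ℝ)`:
there are complementary commuting Lie ideals `b1` (2-dimensional abelian) and `b2`
(with a basis `u, v` satisfying `⁅u,v⁆ = v`). -/
theorem R2_semidirect_aff_is_direct
    (g : Type*) [LieRing g] [LieAlgebra ℝ g] [Module.Finite ℝ g]
    (hdim : Module.finrank ℝ g = 4)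
    (a : LieIdeal ℝ g) (z w : g) (hz : z ∈ a) (hw : w ∈ a)
    (hzw_indep : LinearIndependent ℝ ![z, w])
    (hzw_span : Submodule.span ℝ {z, w} = a.toSubmodule)
    (hzw : ⁅z, w⁆ = w)
    (h : LieSubalgebra ℝ g) (hab : IsLieAbelian h)
    (hhdim : Module.finrank ℝ h = 2)
    (hcompl : IsCompl h.toSubmodule a.toSubmodule) :
    ∃ b1 b2 : LieIdeal ℝ g,
      IsCompl b1.toSubmodule b2.toSubmodule ∧
      (∀ p ∈ b1, ∀ q ∈ b2, ⁅p, q⁆ = 0) ∧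
      (Module.finrank ℝ b1 = 2 ∧ ∀ p ∈ b1, ∀ q ∈ b1, ⁅p, q⁆ = 0) ∧
      (∃ u v : g, u ∈ b2 ∧ v ∈ b2 ∧ LinearIndependent ℝ ![u, v] ∧
        Submodule.span ℝ {u, v} = b2.toSubmodule ∧ ⁅u, v⁆ = v) := by
  have hdisj := a.disjoint_ker_of_aff hzw_indep hzw_span hzw
  have hcompl' : IsCompl (LieModule.ker ℝ g a).toSubmodule a.toSubmodule := by
    refine ⟨hdisj, ?_⟩
    rw [codisjoint_iff, Submodule.eq_top_iff']
    intro x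
    obtain ⟨y, hy, hxy⟩ := a.exists_sub_mem_ker_of_aff hzw_indep hzw_span hzw x
    exact Submodule.mem_sup.2 ⟨x - y, hxy, y, hy, sub_add_cancel x y⟩
  refine ⟨LieModule.ker ℝ g a, a, hcompl', fun p hp q hq => ?_, ⟨?_, fun p hp q hq => ?_⟩,
    z, w, hz, hw, hzw_indep, hzw_span, hzw⟩
  · exact congrArg Subtype.val ((LieModule.mem_ker ..).1 hp ⟨q, hq⟩)
  · have h1 : Module.finrank ℝ h + Module.finrank ℝ a = Module.finrank ℝ g :=
      Submodule.finrank_add_eq_of_isCompl hcompl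
    have h2 : Module.finrank ℝ (LieModule.ker ℝ g a) + Module.finrank ℝ a = Module.finrank ℝ g :=
      Submodule.finrank_add_eq_of_isCompl hcompl'
    omega
  · exact Submodule.disjoint_def.1 hdisj _ (lie_mem_right ℝ g _ p q hq)
      (a.lie_mem_of_codisjoint_isLieAbelian h hcompl.codisjoint p q)
end
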